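/- Let n ≥ 2 and let Ω ⊂ ℝⁿ be a bounded domain which is a local Sobolev–Poincaré imbedding domain of order n, i.e. there exist constants C ≥ 1, λ ≥ 1 and A > 0 such that for every locally Lipschitz function u : Ω → ℝ, every x ∈ Ω and every 0 < r < diam(Ω) with 0 < ∫_{B(x,λr)∩Ω} |∇u(y)|ⁿ dy < ∞, one has inf_{c∈ℝ} ∫_{B(x,r)∩Ω} exp( (A |u(y) − c| / (∫_{B(x,λr)∩Ω} |∇u(z)|ⁿ dz)^{1/n})^{n/(n−1)} ) dy ≤ C |B(x,r)|. Then Ω is quasiconvex. -/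

import Mathlib

open Set Metric MeasureTheory ENNReal NNReal

noncomputable section

/-- Euclidean space `ℝⁿ`. -/
abbrev Euc (n : ℕ) : Type := EuclideanSpace ℝ (Fin n)

/-- `u` is locally Lipschitz on the set `Ω`. -/
def LocallyLipschitzOnSet {n : ℕ} (u : Euc n → ℝ) (Ω : Set (Euc n)) : Prop :=
  ∀ x ∈ Ω, ∃ K : ℝ≥0, ∃ s ∈ nhdsWithin x Ω, LipschitzOnWith K u s

/-- `x` and `y` are joined by a (continuous) curve lying in `S`. -/
def JoinedByCurveIn {n : ℕ} (S : Set (Euc n)) (x y : Euc n) : Prop :=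
  ∃ γ : ℝ → Euc n, ContinuousOn γ (Icc 0 1) ∧ γ 0 = x ∧ γ 1 = y ∧ MapsTo γ (Icc 0 1) S

/-- `γ` is parametrized by arclength on `[0, L]`. -/
def ArclengthOn {n : ℕ} (γ : ℝ → Euc n) (L : ℝ) : Prop :=
  ∀ s t : ℝ, 0 ≤ s → s ≤ t → t ≤ L → eVariationOn γ (Icc s t) = ENNReal.ofReal (t - s)

/-- `Ω` is an `ε₀`-uniform domain. -/
def IsUniformWith {n : ℕ} (Ω : Set (Euc n)) (ε₀ : ℝ) : Prop :=
  ∀ x ∈ Ω, ∀ y ∈ Ω, ∃ γ : ℝ → Euc n,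
    ContinuousOn γ (Icc 0 1) ∧ γ 0 = x ∧ γ 1 = y ∧ MapsTo γ (Icc 0 1) Ω ∧
    eVariationOn γ (Icc 0 1) ≤ ENNReal.ofReal (dist x y / ε₀) ∧
    ∀ t ∈ Icc (0:ℝ) 1,
      ε₀ * (dist x (γ t) * dist y (γ t)) / dist x y ≤ infDist (γ t) (frontier Ω)

/-- `Ω` is a uniform domain. -/
def IsUniformDomain {n : ℕ} (Ω : Set (Euc n)) : Prop :=
  ∃ ε₀ : ℝ, 0 < ε₀ ∧ ε₀ ≤ 1 ∧ IsUniformWith Ω ε₀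

/-- `Ω` is an `α`-cigar domain: any two points can be joined by a rectifiable
(arclength-parametrized) curve in `Ω` along which
`∫_γ dist(z, ∂Ω)^(α-1) |dz| ≤ C |x - y|^α`. -/
def IsCigarDomain {n : ℕ} (Ω : Set (Euc n)) (α : ℝ) : Prop :=
  ∃ C : ℝ, 0 < C ∧ ∀ x ∈ Ω, ∀ y ∈ Ω, ∃ L : ℝ, 0 ≤ L ∧ ∃ γ : ℝ → Euc n,
    γ 0 = x ∧ γ L = y ∧ MapsTo γ (Icc 0 L) Ω ∧ ArclengthOn γ L ∧
    (∫⁻ t in Icc (0:ℝ) L, ENNReal.ofReal (infDist (γ t) (frontier Ω) ^ (α - 1)) ∂volume)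
      ≤ ENNReal.ofReal (C * dist x y ^ α)

/-- `Ω` is a `c₀`-John domain. -/
def IsJohnDomain {n : ℕ} (Ω : Set (Euc n)) (c₀ : ℝ) : Prop :=
  ∃ x₀ ∈ Ω, ∀ x ∈ Ω, ∃ l : ℝ, 0 ≤ l ∧ ∃ γ : ℝ → Euc n,
    γ 0 = x ∧ γ l = x₀ ∧ MapsTo γ (Icc 0 l) Ω ∧ ArclengthOn γ l ∧
    ∀ t ∈ Icc (0:ℝ) l, c₀ * t ≤ infDist (γ t) (frontier Ω)

/-- `Ω` has the `C`-slice property with respect to `x₀`. -/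
def HasSliceProperty {n : ℕ} (Ω : Set (Euc n)) (C : ℝ) (x₀ : Euc n) : Prop :=
  ∀ x ∈ Ω, ∃ γ : ℝ → Euc n,
    ContinuousOn γ (Icc 0 1) ∧ γ 0 = x₀ ∧ γ 1 = x ∧ MapsTo γ (Icc 0 1) Ω ∧
    ∃ j : ℕ, ∃ U : Fin (j + 1) → Set (Euc n),
      (∀ i, IsOpen (U i) ∧ U i ⊆ Ω) ∧
      (Pairwise fun i₁ i₂ => Disjoint (U i₁) (U i₂)) ∧
      -- (1)
      x₀ ∈ U 0 ∧ x ∈ U (Fin.last j) ∧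
      (∀ i : Fin (j + 1), 0 < (i : ℕ) → (i : ℕ) < j →
        x₀ ∈ Ω \ closure (U i) ∧ x ∈ Ω \ closure (U i) ∧
        x ∉ connectedComponentIn (Ω \ closure (U i)) x₀) ∧
      -- (2)
      (∀ i : Fin (j + 1), 0 < (i : ℕ) → (i : ℕ) < j →
        ∀ γ' : ℝ → Euc n, ContinuousOn γ' (Icc 0 1) → MapsTo γ' (Icc 0 1) Ω →
          (∃ t ∈ Icc (0:ℝ) 1, γ' t = x) → (∃ t ∈ Icc (0:ℝ) 1, γ' t = x₀) →
          ENNReal.ofReal (diam (U i)) ≤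
            ENNReal.ofReal C * eVariationOn γ' {t ∈ Icc (0:ℝ) 1 | γ' t ∈ U i}) ∧
      -- (3)
      (∀ t ∈ Icc (0:ℝ) 1,
        ball (γ t) (infDist (γ t) (frontier Ω) / C) ⊆ ⋃ i, closure (U i)) ∧
      -- (4)
      (∀ i : Fin (j + 1), ∀ t ∈ Icc (0:ℝ) 1, γ t ∈ U i →
        diam (U i) ≤ C * infDist (γ t) (frontier Ω)) ∧
      (∀ i : Fin (j + 1), ∃ xi ∈ U i, (∃ t ∈ Icc (0:ℝ) 1, γ t = xi) ∧
        ((i : ℕ) = j → xi = x) ∧ ball xi (infDist xi (frontier Ω) / C) ⊆ U i)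

/-- `Ω` satisfies the slice condition. -/
def SliceCondition {n : ℕ} (Ω : Set (Euc n)) : Prop :=
  ∃ C : ℝ, 1 < C ∧ ∀ x₀ ∈ Ω, HasSliceProperty Ω C x₀

/-- `Ω` is LLC. -/
def IsLLC {n : ℕ} (Ω : Set (Euc n)) : Prop :=
  ∃ b : ℝ, 0 < b ∧ b ≤ 1 ∧ ∀ z : Euc n, ∀ r : ℝ, 0 < r →
    (∀ x ∈ Ω ∩ ball z r, ∀ y ∈ Ω ∩ ball z r, JoinedByCurveIn (Ω ∩ ball z (r / b)) x y) ∧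
    (∀ x ∈ Ω \ ball z r, ∀ y ∈ Ω \ ball z r, JoinedByCurveIn (Ω \ ball z (b * r)) x y)

/-- `Ω` is quasiconvex. -/
def IsQuasiconvex {n : ℕ} (Ω : Set (Euc n)) : Prop :=
  ∃ C : ℝ, 1 ≤ C ∧ ∀ x ∈ Ω, ∀ y ∈ Ω, ∃ γ : ℝ → Euc n,
    ContinuousOn γ (Icc 0 1) ∧ γ 0 = x ∧ γ 1 = y ∧ MapsTo γ (Icc 0 1) Ω ∧
    eVariationOn γ (Icc 0 1) ≤ ENNReal.ofReal (C * dist x y)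

/-- The intrinsic (inner) metric of `Ω` (`∞` if there is no rectifiable curve). -/
def intrinsicDist {n : ℕ} (Ω : Set (Euc n)) (x y : Euc n) : ℝ≥0∞ :=
  ⨅ (γ : ℝ → Euc n)
    (_ : ContinuousOn γ (Icc 0 1) ∧ γ 0 = x ∧ γ 1 = y ∧ MapsTo γ (Icc 0 1) Ω),
    eVariationOn γ (Icc 0 1)

/-- The intrinsic ball `B_Ω(x, r)`. -/
def intrinsicBall {n : ℕ} (Ω : Set (Euc n)) (x : Euc n) (r : ℝ) : Set (Euc n) :=
  {y ∈ Ω | intrinsicDist Ω x y < ENNReal.ofReal r}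

/-- `Ω` is intrinsic Ahlfors `n`-regular. -/
def IntrinsicAhlforsRegular {n : ℕ} (Ω : Set (Euc n)) : Prop :=
  ∃ c : ℝ, 0 < c ∧ c < 1 ∧ ∃ r₀ : ℝ, 0 < r₀ ∧ ∀ x ∈ Ω, ∀ r : ℝ, 0 < r → r < r₀ →
    ENNReal.ofReal c * volume (ball x r) ≤ volume (intrinsicBall Ω x r)

/-- `Ω` is a local Sobolev–Poincaré imbedding domain of order `p`, `1 ≤ p < n`. -/
def LocalSPLow (n : ℕ) (Ω : Set (Euc n)) (p : ℝ) : Prop :=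
  ∃ C : ℝ, 1 ≤ C ∧ ∃ lam : ℝ, 1 ≤ lam ∧
    ∀ u : Euc n → ℝ, LocallyLipschitzOnSet u Ω →
      ∀ x ∈ Ω, ∀ r : ℝ, 0 < r → r < diam Ω →
        (⨅ c : ℝ, (∫⁻ y in ball x r ∩ Ω,
            ENNReal.ofReal |u y - c| ^ ((n : ℝ) * p / ((n : ℝ) - p)) ∂volume)
              ^ (((n : ℝ) - p) / ((n : ℝ) * p)))
          ≤ ENNReal.ofReal C *
            (∫⁻ y in ball x (lam * r) ∩ Ω,
              ENNReal.ofReal ‖fderiv ℝ u y‖ ^ p ∂volume) ^ (1 / p)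

/-- `Ω` is a local Sobolev–Poincaré imbedding domain of order `n`
(local Trudinger inequality). -/
def LocalSPn (n : ℕ) (Ω : Set (Euc n)) : Prop :=
  ∃ C : ℝ, 1 ≤ C ∧ ∃ lam : ℝ, 1 ≤ lam ∧ ∃ A : ℝ, 0 < A ∧
    ∀ u : Euc n → ℝ, LocallyLipschitzOnSet u Ω →
      ∀ x ∈ Ω, ∀ r : ℝ, 0 < r → r < diam Ω →
        0 < (∫⁻ y in ball x (lam * r) ∩ Ω,
              ENNReal.ofReal ‖fderiv ℝ u y‖ ^ (n : ℝ) ∂volume) →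
        (∫⁻ y in ball x (lam * r) ∩ Ω,
              ENNReal.ofReal ‖fderiv ℝ u y‖ ^ (n : ℝ) ∂volume) < ⊤ →
        (⨅ c : ℝ, ∫⁻ y in ball x r ∩ Ω,
            ENNReal.ofReal (Real.exp ((A * |u y - c| /
              (∫⁻ z in ball x (lam * r) ∩ Ω,
                ENNReal.ofReal ‖fderiv ℝ u z‖ ^ (n : ℝ) ∂volume).toReal
                  ^ ((1 : ℝ) / (n : ℝ))) ^ ((n : ℝ) / ((n : ℝ) - 1)))) ∂volume)
          ≤ ENNReal.ofReal C * volume (ball x r)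

/-- `Ω` is a local Sobolev–Poincaré imbedding domain of order `p`, `n < p < ∞`
(local Morrey inequality). -/
def LocalSPHigh (n : ℕ) (Ω : Set (Euc n)) (p : ℝ) : Prop :=
  ∃ C : ℝ, 1 ≤ C ∧ ∃ lam : ℝ, 1 ≤ lam ∧
    ∀ u : Euc n → ℝ, LocallyLipschitzOnSet u Ω →
      ∀ x ∈ Ω, ∀ r : ℝ, 0 < r → r < diam Ω →
        ∀ x₁ ∈ ball x r ∩ Ω, ∀ x₂ ∈ ball x r ∩ Ω,
          ENNReal.ofReal |u x₁ - u x₂| ≤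
            ENNReal.ofReal (C * dist x₁ x₂ ^ (1 - (n : ℝ) / p)) *
              (∫⁻ y in ball x (lam * r) ∩ Ω,
                ENNReal.ofReal ‖fderiv ℝ u y‖ ^ p ∂volume) ^ (1 / p)

/-- `Ω` is a `p`-Poincaré domain. -/
def PoincareDomain (n : ℕ) (Ω : Set (Euc n)) (p : ℝ) : Prop :=
  ∃ C : ℝ, 1 ≤ C ∧ ∃ lam : ℝ, 1 ≤ lam ∧
    ∀ u : Euc n → ℝ, LocallyLipschitzOnSet u Ω →
      ∀ x ∈ Ω, ∀ r : ℝ, 0 < r → r < diam Ω →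
        (volume (ball x r ∩ Ω))⁻¹ *
          (∫⁻ y in ball x r ∩ Ω,
            ENNReal.ofReal |u y - ⨍ z in ball x r ∩ Ω, u z ∂volume| ∂volume)
          ≤ ENNReal.ofReal (C * r) *
            ((volume (ball x (lam * r) ∩ Ω))⁻¹ *
              ∫⁻ y in ball x (lam * r) ∩ Ω,
                ENNReal.ofReal ‖fderiv ℝ u y‖ ^ p ∂volume) ^ (1 / p)



lemma intrinsicDist_le_eVariationOn {n : ℕ} {Ω : Set (Euc n)} {x y : Euc n} {γ : ℝ → Euc n}
    (h : ContinuousOn γ (Icc 0 1) ∧ γ 0 = x ∧ γ 1 = y ∧ MapsTo γ (Icc 0 1) Ω) :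
    intrinsicDist Ω x y ≤ eVariationOn γ (Icc 0 1) :=
  iInf₂_le γ h

lemma exists_curve_of_intrinsicDist_lt {n : ℕ} {Ω : Set (Euc n)} {x y : Euc n} {L : ℝ≥0∞}
    (h : intrinsicDist Ω x y < L) :
    ∃ γ : ℝ → Euc n, (ContinuousOn γ (Icc 0 1) ∧ γ 0 = x ∧ γ 1 = y ∧ MapsTo γ (Icc 0 1) Ω) ∧
      eVariationOn γ (Icc 0 1) < L := by
  simp only [intrinsicDist, iInf_lt_iff] at h
  obtain ⟨γ, h1, h2⟩ := h
  exact ⟨γ, h1, h2⟩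

lemma edist_le_intrinsicDist {n : ℕ} (Ω : Set (Euc n)) (x y : Euc n) :
    edist x y ≤ intrinsicDist Ω x y := by
  refine le_iInf₂ fun γ h => ?_
  obtain ⟨-, h0, h1, -⟩ := h
  rw [← h0, ← h1]
  exact eVariationOn.edist_le γ (by simp) (by simp)

lemma intrinsicDist_symm_le {n : ℕ} (Ω : Set (Euc n)) (x y : Euc n) :
    intrinsicDist Ω y x ≤ intrinsicDist Ω x y := by
  refine le_iInf₂ fun γ h => ?_
  obtain ⟨hc, h0, h1, hm⟩ := h
  have hmaps : MapsTo (fun t : ℝ => 1 - t) (Icc 0 1) (Icc 0 1) := fun t ht =>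
    ⟨by linarith [ht.2], by linarith [ht.1]⟩
  refine (intrinsicDist_le_eVariationOn (γ := γ ∘ fun t => 1 - t)
    ⟨hc.comp (by fun_prop) hmaps, by simpa using h1, by simpa using h0, hm.comp hmaps⟩).trans ?_
  exact eVariationOn.comp_le_of_antitoneOn _ _ (fun a _ b _ hab => sub_le_sub_left hab 1) hmaps

lemma intrinsicDist_comm {n : ℕ} (Ω : Set (Euc n)) (x y : Euc n) :
    intrinsicDist Ω x y = intrinsicDist Ω y x :=
  le_antisymm (intrinsicDist_symm_le Ω y x) (intrinsicDist_symm_le Ω x y)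

lemma intrinsicDist_triangle {n : ℕ} (Ω : Set (Euc n)) (x y z : Euc n) :
    intrinsicDist Ω x z ≤ intrinsicDist Ω x y + intrinsicDist Ω y z := by
  refine ENNReal.le_of_forall_pos_le_add fun ε hε hfin => ?_
  have hε2 : (ε / 2 : ℝ≥0∞) ≠ 0 := by simp [hε.ne']
  obtain ⟨γ₁, ⟨hc1, h10, h11, hm1⟩, hv1⟩ := exists_curve_of_intrinsicDist_lt
    (ENNReal.lt_add_right (ENNReal.add_lt_top.1 hfin).1.ne hε2)
  obtain ⟨γ₂, ⟨hc2, h20, h21, hm2⟩, hv2⟩ := exists_curve_of_intrinsicDist_lt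
    (ENNReal.lt_add_right (ENNReal.add_lt_top.1 hfin).2.ne hε2)
  set γ : ℝ → Euc n := fun t => if t ≤ 1 / 2 then γ₁ (2 * t) else γ₂ (2 * t - 1) with hγ
  have e1 : EqOn γ (γ₁ ∘ fun t => 2 * t) (Icc 0 (1 / 2)) := fun t ht => if_pos ht.2
  have e2 : EqOn γ (γ₂ ∘ fun t => 2 * t - 1) (Icc (1 / 2) 1) := fun t ht => by
    rcases ht.1.eq_or_lt with h | h
    · simp [hγ, ← h, h11, h20]
    · simp [hγ, not_le.2 (by simpa using h)]
  have m1 : MapsTo (fun t : ℝ => 2 * t) (Icc 0 (1 / 2)) (Icc 0 1) := fun t ht =>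
    ⟨by linarith [ht.1], by linarith [ht.2]⟩
  have m2 : MapsTo (fun t : ℝ => 2 * t - 1) (Icc (1 / 2) 1) (Icc 0 1) := fun t ht =>
    ⟨by linarith [ht.1], by linarith [ht.2]⟩
  have hU : Icc (0 : ℝ) (1 / 2) ∪ Icc (1 / 2) 1 = Icc 0 1 :=
    Icc_union_Icc_eq_Icc (by norm_num) (by norm_num)
  have hcont : ContinuousOn γ (Icc 0 1) := by
    rw [← hU]
    exact ((hc1.comp (by fun_prop) m1).congr e1).union_of_isClosed
      ((hc2.comp (by fun_prop) m2).congr e2) isClosed_Icc isClosed_Icc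
  have hmaps : MapsTo γ (Icc 0 1) Ω := by
    rw [← hU]
    exact ((hm1.comp m1).congr e1.symm).union_union ((hm2.comp m2).congr e2.symm) |>.mono_right
      (by simp)
  refine (intrinsicDist_le_eVariationOn ⟨hcont, ?_, ?_, hmaps⟩).trans ?_
  · rw [e1 (by simp)]; simpa using h10
  · rw [e2 (by norm_num)]
    simp only [Function.comp]
    norm_num [h21]
  · have hsum := eVariationOn.Icc_add_Icc γ (s := univ) (a := 0) (b := 1 / 2) (c := (1 : ℝ))
      (by norm_num) (by norm_num) (mem_univ _)
    simp only [univ_inter] at hsum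
    rw [← hsum, eVariationOn.eq_of_eqOn e1, eVariationOn.eq_of_eqOn e2]
    calc _ ≤ eVariationOn γ₁ (Icc 0 1) + eVariationOn γ₂ (Icc 0 1) := by
          gcongr
          · exact eVariationOn.comp_le_of_monotoneOn _ _ (fun a _ b _ hab => by simpa using hab) m1
          · exact eVariationOn.comp_le_of_monotoneOn _ _ (fun a _ b _ hab => by simpa using hab) m2
      _ ≤ (intrinsicDist Ω x y + ε / 2) + (intrinsicDist Ω y z + ε / 2) := by gcongr
      _ = _ := by rw [add_add_add_comm, ENNReal.add_halves]

lemma intrinsicDist_le_edist {n : ℕ} {Ω : Set (Euc n)} {x y : Euc n} (h : segment ℝ x y ⊆ Ω) :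
    intrinsicDist Ω x y ≤ edist x y := by
  have hm : MapsTo (AffineMap.lineMap x y : ℝ → Euc n) (Icc 0 1) Ω := fun t ht =>
    h (segment_eq_image_lineMap ℝ x y ▸ mem_image_of_mem _ ht)
  refine (intrinsicDist_le_eVariationOn (γ := AffineMap.lineMap x y)
    ⟨by fun_prop, by simp, by simp, hm⟩).trans ?_
  have hl : LipschitzOnWith (nndist x y) (AffineMap.lineMap x y : ℝ → Euc n) univ :=
    (lipschitzWith_lineMap x y).lipschitzOnWith
  have h1 := hl.comp_eVariationOn_le (g := id) (s := Icc (0 : ℝ) 1) (mapsTo_univ _ _)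
  have h2 := (monotone_id.monotoneOn (Icc (0 : ℝ) 1)).eVariationOn_eq (a := 0) (b := 1)
    (by simp) (by simp)
  simp only [inter_self, id, sub_zero, ENNReal.ofReal_one] at h2
  change eVariationOn id (Icc (0 : ℝ) 1) = 1 at h2
  rw [h2, mul_one] at h1
  rw [edist_nndist]
  exact h1

lemma intrinsicDist_ne_top {n : ℕ} {Ω : Set (Euc n)} (hOpen : IsOpen Ω)
    (hConn : IsConnected Ω) {x y : Euc n} (hx : x ∈ Ω) (hy : y ∈ Ω) :
    intrinsicDist Ω x y ≠ ⊤ := by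
  refine hConn.isPreconnected.induction₂' (fun x y => intrinsicDist Ω x y ≠ ⊤) ?_ ?_ hx hy
  · intro x hx
    obtain ⟨δ, hδ, hb⟩ := Metric.isOpen_iff.1 hOpen x hx
    filter_upwards [mem_nhdsWithin_of_mem_nhds (ball_mem_nhds x hδ)] with y hy
    have : intrinsicDist Ω x y ≠ ⊤ := ne_top_of_le_ne_top (edist_ne_top x y)
      (intrinsicDist_le_edist (((convex_ball x δ).segment_subset (mem_ball_self hδ) hy).trans hb))
    exact ⟨this, intrinsicDist_comm Ω x y ▸ this⟩
  · intro x y z _ _ _ h1 h2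
    exact ne_top_of_le_ne_top (ENNReal.add_ne_top.2 ⟨h1, h2⟩) (intrinsicDist_triangle Ω x y z)

lemma pow_div_factorial_le_exp_rpow {z p : ℝ} (hz : 0 ≤ z) (hp : 1 ≤ p) (k : ℕ) :
    z ^ k / k.factorial ≤ Real.exp (z ^ p) := by
  have hk : (1 : ℝ) ≤ k.factorial := by exact_mod_cast k.factorial_pos
  rcases le_total z 1 with h | h
  · calc z ^ k / k.factorial ≤ 1 := div_le_one_of_le₀ ((pow_le_one₀ hz h).trans hk) (by positivity)
      _ ≤ _ := Real.one_le_exp (Real.rpow_nonneg hz p)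
  · refine (Real.pow_div_factorial_le_exp z hz k).trans (Real.exp_le_exp.2 ?_)
    simpa using Real.rpow_le_rpow_of_exponent_le h hp

lemma volume_ball_eq {n : ℕ} (hn : 2 ≤ n) (x : Euc n) {r : ℝ} (hr : 0 ≤ r) :
    volume (ball x r) = ENNReal.ofReal (r ^ n * volume.real (ball (0 : Euc n) 1)) := by
  have : Nontrivial (Euc n) := by
    have : Nonempty (Fin n) := ⟨⟨0, by omega⟩⟩
    infer_instance
  rw [Measure.addHaar_ball _ _ hr, finrank_euclideanSpace_fin,
    ENNReal.ofReal_mul (by positivity), ofReal_measureReal measure_ball_lt_top.ne]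

/-- If a function of energy at most `G` separates two subsets of `B(x, r) ∩ Ω`, then one of them has
measure at most `K r ^ n G ^ 2`. -/
def SeparationBound (n : ℕ) (Ω : Set (Euc n)) (K lam : ℝ) : Prop :=
  ∀ u : Euc n → ℝ, LocallyLipschitzOnSet u Ω →
    ∀ x ∈ Ω, ∀ r : ℝ, 0 < r → r < diam Ω → ∀ G : ℝ,
      0 < (∫⁻ y in ball x (lam * r) ∩ Ω, ENNReal.ofReal ‖fderiv ℝ u y‖ ^ (n : ℝ) ∂volume) →
      (∫⁻ y in ball x (lam * r) ∩ Ω, ENNReal.ofReal ‖fderiv ℝ u y‖ ^ (n : ℝ) ∂volume)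
        ≤ ENNReal.ofReal G →
      ∀ E ⊆ ball x r ∩ Ω, MeasurableSet E → (∀ y ∈ E, u y ≤ 0) →
      ∀ F ⊆ ball x r ∩ Ω, MeasurableSet F → (∀ y ∈ F, 1 ≤ u y) →
        min (volume.real E) (volume.real F) ≤ K * r ^ n * G ^ 2

/-- The exponential integrability of order `n` controls the measure of the sets separated by a
function of small energy. -/
lemma LocalSPn.exists_separationBound {n : ℕ} (hn : 2 ≤ n) {Ω : Set (Euc n)}
    (hSP : LocalSPn n Ω) :
    ∃ K : ℝ, 0 < K ∧ ∃ lam : ℝ, 1 ≤ lam ∧ SeparationBound n Ω K lam := by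
  obtain ⟨C, hC, lam, hlam, A, hA, h⟩ := hSP
  set ω := volume.real (ball (0 : Euc n) 1) with hω
  have hω0 : 0 < ω := ENNReal.toReal_pos (measure_ball_pos _ _ one_pos).ne' measure_ball_lt_top.ne
  have hn0 : (0 : ℝ) < n := by positivity
  have hn1 : (1 : ℝ) < n := by exact_mod_cast hn
  have hp : 1 ≤ (n : ℝ) / ((n : ℝ) - 1) := by
    rw [one_le_div (by linarith)]; linarith
  refine ⟨2 * C * ω * (2 * n).factorial / (A / 2) ^ (2 * n), by positivity, lam, hlam, ?_⟩
  intro u hu x hx r hr hrd G hI0 hIG E hE hEm hEu F hF hFm hFu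
  have hItop := hIG.trans_lt ENNReal.ofReal_lt_top
  have hinf := h u hu x hx r hr hrd hI0 hItop
  set I := ∫⁻ y in ball x (lam * r) ∩ Ω, ENNReal.ofReal ‖fderiv ℝ u y‖ ^ (n : ℝ) ∂volume with hI
  have hIr : 0 < I.toReal := ENNReal.toReal_pos hI0.ne' hItop.ne
  have hG0 : 0 < G := ENNReal.ofReal_pos.1 (hI0.trans_le hIG)
  have hIG' : I.toReal ≤ G := ENNReal.toReal_le_of_le_ofReal hG0.le hIG
  have hlt : ENNReal.ofReal C * volume (ball x r) < ENNReal.ofReal (2 * C * (r ^ n * ω)) := by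
    rw [volume_ball_eq hn x hr.le, ← ENNReal.ofReal_mul (by positivity)]
    refine (ENNReal.ofReal_lt_ofReal_iff (by positivity)).2 ?_
    have : 0 < C * (r ^ n * ω) := by positivity
    linarith
  obtain ⟨c, hc⟩ := iInf_lt_iff.1 (hinf.trans_lt hlt)
  have key : ∀ S ⊆ ball x r ∩ Ω, MeasurableSet S → (∀ y ∈ S, 1 / 2 ≤ |u y - c|) →
      volume.real S ≤ 2 * C * ω * (2 * n).factorial / (A / 2) ^ (2 * n) * r ^ n * G ^ 2 := by
    intro S hS hSm hSu
    have hb : ∀ y ∈ S, (A / 2) ^ (2 * n) / G ^ 2 / (2 * n).factorial ≤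
        Real.exp ((A * |u y - c| / I.toReal ^ ((1 : ℝ) / (n : ℝ))) ^ ((n : ℝ) / ((n : ℝ) - 1))) := by
      intro y hy
      refine le_trans ?_ (pow_div_factorial_le_exp_rpow (by positivity) hp (2 * n))
      gcongr
      have : (I.toReal ^ ((1 : ℝ) / (n : ℝ))) ^ (2 * n) = I.toReal ^ 2 := by
        rw [mul_comm, pow_mul, ← Real.rpow_natCast (I.toReal ^ ((1 : ℝ) / (n : ℝ))) n,
          ← Real.rpow_mul hIr.le, one_div_mul_cancel hn0.ne', Real.rpow_one]
      rw [div_pow (A * |u y - c|), this]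
      have := hSu y hy
      gcongr
      nlinarith
    have h1 := (setLIntegral_mono' (μ := volume) hSm
      fun y hy => ENNReal.ofReal_le_ofReal (hb y hy)).trans
      ((lintegral_mono_set hS).trans hc.le)
    rw [setLIntegral_const] at h1
    have hfin : volume S ≠ ⊤ :=
      measure_ne_top_of_subset (hS.trans inter_subset_left) measure_ball_lt_top.ne
    have h2 := ENNReal.toReal_le_of_le_ofReal (by positivity) h1
    rw [ENNReal.toReal_mul, ENNReal.toReal_ofReal (by positivity)] at h2
    change _ * volume.real S ≤ _ at h2
    rw [div_div, div_mul_eq_mul_div, div_le_iff₀ (by positivity)] at h2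
    rw [div_mul_eq_mul_div, div_mul_eq_mul_div, le_div_iff₀ (by positivity)]
    linarith
  rcases le_total c (1 / 2) with hc2 | hc2
  · exact (min_le_right _ _).trans (key F hF hFm fun y hy =>
      le_abs.2 (Or.inl (by linarith [hFu y hy])))
  · exact (min_le_left _ _).trans (key E hE hEm fun y hy =>
      le_abs.2 (Or.inr (by linarith [hEu y hy])))

/-- The intrinsic metric of `Ω` as a real number. -/
def innerDist {n : ℕ} (Ω : Set (Euc n)) (x y : Euc n) : ℝ :=
  (intrinsicDist Ω x y).toReal

/-- The ball of the real-valued intrinsic metric of `Ω`. -/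
def innerBall {n : ℕ} (Ω : Set (Euc n)) (x : Euc n) (r : ℝ) : Set (Euc n) :=
  {y ∈ Ω | innerDist Ω x y < r}

lemma innerDist_nonneg {n : ℕ} (Ω : Set (Euc n)) (x y : Euc n) : 0 ≤ innerDist Ω x y :=
  ENNReal.toReal_nonneg

lemma innerDist_comm {n : ℕ} (Ω : Set (Euc n)) (x y : Euc n) :
    innerDist Ω x y = innerDist Ω y x := by
  rw [innerDist, intrinsicDist_comm, innerDist]

lemma innerBall_mono {n : ℕ} (Ω : Set (Euc n)) (x : Euc n) {s t : ℝ} (h : s ≤ t) :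
    innerBall Ω x s ⊆ innerBall Ω x t := fun _ hy => ⟨hy.1, hy.2.trans_le h⟩

section innerDist

variable {n : ℕ} {Ω : Set (Euc n)}

lemma dist_le_innerDist (hOpen : IsOpen Ω) (hConn : IsConnected Ω) {x y : Euc n}
    (hx : x ∈ Ω) (hy : y ∈ Ω) : dist x y ≤ innerDist Ω x y := by
  rw [dist_edist]
  exact ENNReal.toReal_mono (intrinsicDist_ne_top hOpen hConn hx hy) (edist_le_intrinsicDist Ω x y)

lemma innerDist_triangle (hOpen : IsOpen Ω) (hConn : IsConnected Ω) {x y z : Euc n}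
    (hx : x ∈ Ω) (hy : y ∈ Ω) (hz : z ∈ Ω) :
    innerDist Ω x z ≤ innerDist Ω x y + innerDist Ω y z := by
  have h1 := intrinsicDist_ne_top hOpen hConn hx hy
  have h2 := intrinsicDist_ne_top hOpen hConn hy hz
  rw [innerDist, innerDist, innerDist, ← ENNReal.toReal_add h1 h2]
  exact ENNReal.toReal_mono (ENNReal.add_ne_top.2 ⟨h1, h2⟩) (intrinsicDist_triangle Ω x y z)

lemma innerDist_le_dist {p x y : Euc n} {δ : ℝ} (hb : ball p δ ⊆ Ω) (hx : x ∈ ball p δ)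
    (hy : y ∈ ball p δ) : innerDist Ω x y ≤ dist x y := by
  rw [dist_edist]
  exact ENNReal.toReal_mono (edist_ne_top x y)
    (intrinsicDist_le_edist (((convex_ball p δ).segment_subset hx hy).trans hb))

lemma innerDist_eq_dist (hOpen : IsOpen Ω) (hConn : IsConnected Ω) {p x y : Euc n} {δ : ℝ}
    (hb : ball p δ ⊆ Ω) (hx : x ∈ ball p δ) (hy : y ∈ ball p δ) :
    innerDist Ω x y = dist x y :=
  (innerDist_le_dist hb hx hy).antisymm (dist_le_innerDist hOpen hConn (hb hx) (hb hy))

lemma lipschitzOnWith_innerDist (hOpen : IsOpen Ω) (hConn : IsConnected Ω) {x : Euc n}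
    (hx : x ∈ Ω) {p : Euc n} {δ : ℝ} (hb : ball p δ ⊆ Ω) :
    LipschitzOnWith 1 (innerDist Ω x) (ball p δ) := by
  refine LipschitzOnWith.of_le_add fun y hy z hz => ?_
  rw [dist_comm]
  exact (innerDist_triangle hOpen hConn hx (hb hz) (hb hy)).trans
    (by gcongr; exact innerDist_le_dist hb hz hy)

lemma continuousOn_innerDist (hOpen : IsOpen Ω) (hConn : IsConnected Ω) {x : Euc n}
    (hx : x ∈ Ω) : ContinuousOn (innerDist Ω x) Ω := by
  intro y hy
  obtain ⟨δ, hδ, hb⟩ := Metric.isOpen_iff.1 hOpen y hy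
  exact ((lipschitzOnWith_innerDist hOpen hConn hx hb).continuousOn.continuousAt
    (ball_mem_nhds y hδ)).continuousWithinAt

lemma isOpen_innerBall (hOpen : IsOpen Ω) (hConn : IsConnected Ω) {x : Euc n}
    (hx : x ∈ Ω) (r : ℝ) : IsOpen (innerBall Ω x r) :=
  (continuousOn_innerDist hOpen hConn hx).isOpen_inter_preimage hOpen isOpen_Iio

lemma innerBall_subset (hOpen : IsOpen Ω) (hConn : IsConnected Ω) {x : Euc n}
    (hx : x ∈ Ω) (r : ℝ) : innerBall Ω x r ⊆ ball x r ∩ Ω := fun y hy =>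
  ⟨by rw [mem_ball, dist_comm]; exact (dist_le_innerDist hOpen hConn hx hy.1).trans_lt hy.2, hy.1⟩

lemma measure_innerBall_ne_top (hOpen : IsOpen Ω) (hConn : IsConnected Ω) {x : Euc n}
    (hx : x ∈ Ω) (r : ℝ) : volume (innerBall Ω x r) ≠ ⊤ :=
  measure_ne_top_of_subset ((innerBall_subset hOpen hConn hx r).trans inter_subset_left)
    measure_ball_lt_top.ne

lemma measureReal_innerBall_pos (hOpen : IsOpen Ω) (hConn : IsConnected Ω) {x : Euc n}
    (hx : x ∈ Ω) {r : ℝ} (hr : 0 < r) : 0 < volume.real (innerBall Ω x r) := by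
  obtain ⟨δ, hδ, hb⟩ := Metric.isOpen_iff.1 hOpen x hx
  refine ENNReal.toReal_pos ((isOpen_innerBall hOpen hConn hx r).measure_pos _ ⟨x, hx, ?_⟩).ne'
    (measure_innerBall_ne_top hOpen hConn hx r)
  rw [innerDist_eq_dist hOpen hConn hb (mem_ball_self hδ) (mem_ball_self hδ), dist_self]
  exact hr

lemma LocallyLipschitzOnSet.of_ball (hOpen : IsOpen Ω) {u : Euc n → ℝ} {k : ℝ≥0}
    (h : ∀ p δ, ball p δ ⊆ Ω → LipschitzOnWith k u (ball p δ)) : LocallyLipschitzOnSet u Ω := by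
  intro x hx
  obtain ⟨δ, hδ, hb⟩ := Metric.isOpen_iff.1 hOpen x hx
  exact ⟨k, _, mem_nhdsWithin_of_mem_nhds (ball_mem_nhds x hδ), h x δ hb⟩

lemma lintegral_fderiv_pow_le (hOpen : IsOpen Ω) {u : Euc n → ℝ} {k : ℝ≥0}
    (h : ∀ p δ, ball p δ ⊆ Ω → LipschitzOnWith k u (ball p δ)) (hn : n ≠ 0) {S T : Set (Euc n)}
    (hSm : MeasurableSet S) (hSfin : volume S ≠ ⊤) (hT : T ⊆ Ω) (hTm : MeasurableSet T)
    (h0 : ∀ y ∈ T, y ∉ S → fderiv ℝ u y = 0) :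
    (∫⁻ y in T, ENNReal.ofReal ‖fderiv ℝ u y‖ ^ (n : ℝ) ∂volume)
      ≤ ENNReal.ofReal ((k : ℝ) ^ n * volume.real S) := by
  calc _ ≤ ∫⁻ y in T, S.indicator (fun _ => ENNReal.ofReal ((k : ℝ) ^ n)) y ∂volume := by
        refine setLIntegral_mono' hTm fun y hy => ?_
        by_cases hyS : y ∈ S
        · obtain ⟨δ, hδ, hb⟩ := Metric.isOpen_iff.1 hOpen y (hT hy)
          rw [indicator_of_mem hyS, ENNReal.rpow_natCast, ENNReal.ofReal_pow k.coe_nonneg]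
          gcongr
          exact norm_fderiv_le_of_lipschitzOn ℝ (ball_mem_nhds y hδ) (h y δ hb)
        · simp [h0 y hy hyS, hn]
    _ ≤ ENNReal.ofReal ((k : ℝ) ^ n) * volume S := by
        rw [setLIntegral_indicator hSm, setLIntegral_const]
        gcongr
        exact inter_subset_left
    _ = _ := by rw [ENNReal.ofReal_mul (by positivity), ofReal_measureReal hSfin]

lemma lintegral_fderiv_pow_pos (hOpen : IsOpen Ω) {u : Euc n → ℝ} {x : Euc n} (hx : x ∈ Ω)
    {a b δ R : ℝ} (ha : a ≠ 0) (hδ : 0 < δ) (hu : ∀ y ∈ ball x δ, u y = a * dist x y + b)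
    (hn : 2 ≤ n) (hR : 0 < R) :
    0 < ∫⁻ y in ball x R ∩ Ω, ENNReal.ofReal ‖fderiv ℝ u y‖ ^ (n : ℝ) ∂volume := by
  have : Nontrivial (Euc n) := by
    have : Nonempty (Fin n) := ⟨⟨0, by omega⟩⟩
    infer_instance
  set W : Set (Euc n) := (ball x δ ∩ (ball x R ∩ Ω)) ∩ {x}ᶜ with hW
  have hWo : IsOpen W := (isOpen_ball.inter (isOpen_ball.inter hOpen)).inter isOpen_compl_singleton
  have hWne : W.Nonempty := by
    have hmem : ball x δ ∩ (ball x R ∩ Ω) ∈ nhds x :=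
      (isOpen_ball.inter (isOpen_ball.inter hOpen)).mem_nhds
        ⟨mem_ball_self hδ, mem_ball_self hR, hx⟩
    have hne : (nhdsWithin x {x}ᶜ).NeBot := Module.punctured_nhds_neBot ℝ (Euc n) x
    exact Filter.nonempty_of_mem (Filter.inter_mem (mem_nhdsWithin_of_mem_nhds hmem)
      self_mem_nhdsWithin)
  have hfd : ∀ y ∈ W, ‖fderiv ℝ u y‖ = |a| := by
    intro y hy
    have hev : u =ᶠ[nhds y] fun z => a * ‖z - x‖ + b := by
      filter_upwards [isOpen_ball.mem_nhds hy.1.1] with z hz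
      rw [hu z hz, dist_comm, dist_eq_norm]
    have hyx : y - x ≠ 0 := sub_ne_zero.2 hy.2
    have hd : DifferentiableAt ℝ (fun z : Euc n => ‖z‖) (y - x) :=
      differentiableAt_id.norm ℝ hyx
    have hd' : DifferentiableAt ℝ (fun z : Euc n => ‖z - x‖) y :=
      (differentiableAt_id.sub_const x).norm ℝ hyx
    rw [hev.fderiv_eq, fderiv_add_const, fderiv_const_mul hd',
      fderiv_comp_sub (f := fun z : Euc n => ‖z‖), norm_smul, norm_fderiv_norm hd]
    simp
  calc 0 < ENNReal.ofReal |a| ^ (n : ℝ) * volume W :=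
        ENNReal.mul_pos (by simp [ENNReal.rpow_natCast, ha]) (hWo.measure_pos _ hWne).ne'
    _ = ∫⁻ _ in W, ENNReal.ofReal |a| ^ (n : ℝ) ∂volume := (setLIntegral_const _ _).symm
    _ ≤ ∫⁻ y in W, ENNReal.ofReal ‖fderiv ℝ u y‖ ^ (n : ℝ) ∂volume :=
        setLIntegral_mono' hWo.measurableSet fun y hy => by rw [hfd y hy]
    _ ≤ _ := lintegral_mono_set (inter_subset_left.trans inter_subset_right)

end innerDist


lemma exists_lt_of_le_mul_sq {a : ℕ → ℝ} {K B δ : ℝ} (hK : 0 < K) (hB : 1 < B) (hδ : 0 < δ)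
    (ha : ∀ j, δ ≤ a j) (h : ∀ j, a (j + 1) ≤ K * B ^ j * a j ^ 2) : 1 / (K * B) < a 0 := by
  by_contra! h0
  have hB0 : 0 < B := by linarith
  have hb : ∀ j, a j ≤ 1 / (K * B) * (1 / B) ^ j := by
    intro j
    induction j with
    | zero => simpa using h0
    | succ j ih =>
      calc a (j + 1) ≤ K * B ^ j * a j ^ 2 := h j
        _ ≤ K * B ^ j * (1 / (K * B) * (1 / B) ^ j) ^ 2 := by
            have := hδ.le.trans (ha j)
            gcongr
        _ = 1 / (K * B) * (1 / B) ^ (j + 1) := by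
            simp only [one_div_pow, pow_succ]
            field_simp
  have hlim : Filter.Tendsto (fun j : ℕ => 1 / (K * B) * (1 / B) ^ j) Filter.atTop (nhds 0) := by
    simpa using (tendsto_pow_atTop_nhds_zero_of_lt_one (by positivity)
      ((div_lt_one hB0).2 hB)).const_mul (1 / (K * B))
  exact absurd (ge_of_tendsto' hlim fun j => (ha j).trans (hb j)) (not_le.2 hδ)

section Trudinger

variable {n : ℕ} {Ω : Set (Euc n)} {K lam : ℝ}

lemma SeparationBound.min_measureReal_innerBall_le (hn : 2 ≤ n) (hOpen : IsOpen Ω)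
    (hConn : IsConnected Ω) (hlam : 1 ≤ lam) (hK : SeparationBound n Ω K lam) {x : Euc n}
    (hx : x ∈ Ω) {s t R : ℝ} (hs : 0 < s) (hst : s < t) (hsR : s ≤ R) (hR : R < diam Ω) :
    min (volume.real ((ball x R ∩ Ω) \ innerBall Ω x t)) (volume.real (innerBall Ω x s)) ≤
      K * R ^ n * ((1 / (t - s)) ^ n * volume.real (innerBall Ω x t)) ^ 2 := by
  have hts : 0 < t - s := sub_pos.2 hst
  have hR0 : 0 < R := hs.trans_le hsR
  obtain ⟨k, hk⟩ : ∃ k : ℝ≥0, (k : ℝ) = 1 / (t - s) := ⟨⟨_, by positivity⟩, rfl⟩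
  set u : Euc n → ℝ := fun y => max (1 / (t - s) * (t - innerDist Ω x y)) 0 with hu
  have hLip : ∀ p δ, ball p δ ⊆ Ω → LipschitzOnWith k u (ball p δ) := by
    intro p δ hb
    refine LipschitzOnWith.of_dist_le_mul fun y hy z hz => ?_
    have h1 := (lipschitzOnWith_innerDist hOpen hConn hx hb).dist_le_mul y hy z hz
    rw [NNReal.coe_one, one_mul, Real.dist_eq] at h1
    rw [Real.dist_eq]
    refine (abs_max_sub_max_le_abs _ _ _).trans ?_
    rw [← mul_sub, abs_mul, abs_of_pos (by positivity : 0 < 1 / (t - s)), hk]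
    refine mul_le_mul_of_nonneg_left ?_ (by positivity)
    rwa [show t - innerDist Ω x y - (t - innerDist Ω x z) =
      -(innerDist Ω x y - innerDist Ω x z) by ring, abs_neg]
  have hTm : MeasurableSet (ball x (lam * R) ∩ Ω) := (isOpen_ball.inter hOpen).measurableSet
  have hBm : ∀ s, MeasurableSet (innerBall Ω x s) := fun s =>
    (isOpen_innerBall hOpen hConn hx s).measurableSet
  obtain ⟨δ, hδ, hb⟩ := Metric.isOpen_iff.1 hOpen x hx
  refine hK u (.of_ball hOpen hLip) x hx R hR0 hR _ ?_ ?_ _ sdiff_subset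
    ((isOpen_ball.inter hOpen).measurableSet.diff (hBm t)) ?_ _ ?_ (hBm s) ?_
  · refine lintegral_fderiv_pow_pos hOpen hx (a := -(1 / (t - s))) (b := 1 / (t - s) * t)
      (δ := min δ t) (by simpa using hts.ne') (by positivity [hs.trans hst]) ?_ hn (by positivity)
    intro y hy
    have hyδ : y ∈ ball x δ := ball_subset_ball (min_le_left _ _) hy
    have hyt : dist x y < t := by
      rw [dist_comm]; exact (mem_ball.1 hy).trans_le (min_le_right _ _)
    simp only [hu]
    rw [innerDist_eq_dist hOpen hConn hb (mem_ball_self hδ) hyδ, max_eq_left]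
    · ring
    · have := sub_pos.2 hyt
      positivity
  · rw [← hk]
    refine lintegral_fderiv_pow_le hOpen hLip (by omega) (hBm t)
      (measure_innerBall_ne_top hOpen hConn hx t) inter_subset_right hTm ?_
    intro y hy hyt
    have hd : t ≤ innerDist Ω x y := not_lt.1 fun h => hyt ⟨hy.2, h⟩
    have hmin : IsLocalMin u y := by
      refine Filter.Eventually.of_forall fun z => ?_
      have h0 : u y = 0 := max_eq_right (mul_nonpos_of_nonneg_of_nonpos (by positivity)
        (by linarith))
      rw [h0]
      exact le_max_right _ _
    exact hmin.fderiv_eq_zero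
  · rintro y ⟨hy, hyt⟩
    have hd : t ≤ innerDist Ω x y := not_lt.1 fun h => hyt ⟨hy.2, h⟩
    exact (max_eq_right (mul_nonpos_of_nonneg_of_nonpos (by positivity) (by linarith))).le
  · exact (innerBall_subset hOpen hConn hx s).trans
      (inter_subset_inter_left _ (ball_subset_ball hsR))
  · intro y hy
    refine le_max_of_le_left ?_
    rw [one_div_mul_eq_div, one_le_div hts]
    linarith [hy.2]

/-- If the intrinsic ball fills at most half of a Euclidean ball of twice the radius,
then it is large. -/
lemma SeparationBound.lt_measureReal_innerBall (hn : 2 ≤ n) (hOpen : IsOpen Ω)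
    (hConn : IsConnected Ω) (hK0 : 0 < K) (hlam : 1 ≤ lam) (hK : SeparationBound n Ω K lam)
    {x : Euc n} (hx : x ∈ Ω) {r : ℝ} (hr : 0 < r) (hrd : 2 * r < diam Ω)
    (hE : volume.real (innerBall Ω x r) ≤
      volume.real ((ball x (2 * r) ∩ Ω) \ innerBall Ω x r)) :
    1 / (K * 32 ^ n * 4 ^ n) * r ^ n < volume.real (innerBall Ω x r) := by
  set m : ℝ → ℝ := fun s => volume.real (innerBall Ω x s) with hm
  have hmono : ∀ {s t}, s ≤ t → m s ≤ m t := fun h =>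
    measureReal_mono (innerBall_mono Ω x h) (measure_innerBall_ne_top hOpen hConn hx _)
  set ρ : ℕ → ℝ := fun j => r / 2 + r / 2 * (1 / 2) ^ j with hρ
  have hρ0 : ρ 0 = r := by simp only [hρ]; ring
  have hρr : ∀ j, ρ j ≤ r := fun j => by
    have : (1 / 2 : ℝ) ^ j ≤ 1 := pow_le_one₀ (by norm_num) (by norm_num)
    simp only [hρ]
    nlinarith
  have hρl : ∀ j, r / 2 ≤ ρ j := fun j => by
    have : 0 ≤ r / 2 * (1 / 2) ^ j := by positivity
    simp only [hρ]
    linarith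
  have hρd : ∀ j, ρ j - ρ (j + 1) = r / 4 * (1 / 2) ^ j := fun j => by
    simp only [hρ]; ring
  have hstep : ∀ j, m (ρ (j + 1)) / r ^ n ≤
      (K * 32 ^ n) * (4 ^ n) ^ j * (m (ρ j) / r ^ n) ^ 2 := by
    intro j
    have hlt : ρ (j + 1) < ρ j := by
      have := hρd j
      have : 0 < r / 4 * (1 / 2) ^ j := by positivity
      linarith
    have h1 := hK.min_measureReal_innerBall_le hn hOpen hConn hlam hx (s := ρ (j + 1)) (t := ρ j)
      (R := 2 * r) (by linarith [hρl (j + 1)]) hlt (by linarith [hρr (j + 1)]) hrd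
    have h2 : m (ρ (j + 1)) ≤ volume.real ((ball x (2 * r) ∩ Ω) \ innerBall Ω x (ρ j)) :=
      (hmono (hρr _)).trans <| hE.trans <| measureReal_mono
        (sdiff_subset_sdiff_right (innerBall_mono Ω x (hρr j)))
        (measure_ne_top_of_subset (sdiff_subset.trans inter_subset_left) measure_ball_lt_top.ne)
    rw [min_eq_right h2, hρd] at h1
    rw [div_le_iff₀ (by positivity)]
    refine h1.trans_eq ?_
    change K * (2 * r) ^ n * ((1 / (r / 4 * (1 / 2) ^ j)) ^ n * m (ρ j)) ^ 2 = _
    have e1 : (32 : ℝ) ^ n = 2 ^ n * (4 ^ n) ^ 2 := by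
      rw [← pow_mul, mul_comm n 2, pow_mul, ← mul_pow]; norm_num
    have e2 : ((4 : ℝ) ^ n) ^ j = (((2 : ℝ) ^ j) ^ n) ^ 2 := by
      rw [← pow_mul, ← pow_mul, ← pow_mul, show (4 : ℝ) = 2 ^ 2 by norm_num, ← pow_mul]
      congr 1; ring
    have e3 : 1 / (r / 4 * (1 / 2) ^ j) = 4 * 2 ^ j / r := by
      rw [one_div_pow]; field_simp
    rw [e1, e2, e3, div_pow, mul_pow, mul_pow]
    field_simp
    ring
  have := exists_lt_of_le_mul_sq (a := fun j => m (ρ j) / r ^ n) (δ := m (r / 2) / r ^ n)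
    (by positivity) (one_lt_pow₀ (by norm_num : (1 : ℝ) < 4) (by omega))
    (div_pos (measureReal_innerBall_pos hOpen hConn hx (by positivity)) (by positivity))
    (fun j => by gcongr; exact hmono (hρl j)) hstep
  simp only [hρ0] at this
  rwa [lt_div_iff₀ (by positivity)] at this

lemma exists_finite_cover (hBdd : Bornology.IsBounded Ω) {r : ℝ} (hr : 0 < r) :
    ∃ t ⊆ Ω, t.Finite ∧ ∀ x ∈ Ω, ∃ p ∈ t, dist x p < r := by
  obtain ⟨t, htΩ, hfin, hcov⟩ := Metric.finite_approx_of_totallyBounded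
    (hBdd.isCompact_closure.totallyBounded.subset subset_closure) r hr
  exact ⟨t, htΩ, hfin, fun x hx => by simpa using hcov hx⟩

lemma exists_le_measureReal_ball_inter (hOpen : IsOpen Ω) (hBdd : Bornology.IsBounded Ω)
    (hne : Ω.Nonempty) {r : ℝ} (hr : 0 < r) :
    ∃ M : ℝ, 0 < M ∧ ∀ x ∈ Ω, M ≤ volume.real (ball x r ∩ Ω) := by
  obtain ⟨t, htΩ, hfin, hcov⟩ := exists_finite_cover hBdd (half_pos hr)
  obtain ⟨x₀, hx₀⟩ := hne
  obtain ⟨p₀, hp₀, -⟩ := hcov x₀ hx₀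
  obtain ⟨q, hq, hmin⟩ := exists_min_image t (fun p => volume.real (ball p (r / 2) ∩ Ω)) hfin
    ⟨p₀, hp₀⟩
  have hfinite : ∀ (p : Euc n) (s : ℝ), volume (ball p s ∩ Ω) ≠ ⊤ := fun p s =>
    measure_ne_top_of_subset inter_subset_left measure_ball_lt_top.ne
  refine ⟨_, ENNReal.toReal_pos ((isOpen_ball.inter hOpen).measure_pos volume
    ⟨q, mem_ball_self (half_pos hr), htΩ hq⟩).ne' (hfinite q (r / 2)), fun x hx => ?_⟩
  obtain ⟨p, hp, hxp⟩ := hcov x hx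
  refine (hmin p hp).trans (measureReal_mono (inter_subset_inter_left _ ?_) (hfinite x r))
  refine ball_subset_ball' ?_
  rw [dist_comm]
  linarith

/-- Intrinsic balls of radius at most a quarter of the diameter are Ahlfors regular. -/
lemma SeparationBound.exists_le_measureReal_innerBall (hn : 2 ≤ n) (hOpen : IsOpen Ω)
    (hConn : IsConnected Ω) (hBdd : Bornology.IsBounded Ω) (hd : 0 < diam Ω) (hK0 : 0 < K)
    (hlam : 1 ≤ lam) (hK : SeparationBound n Ω K lam) :
    ∃ c : ℝ, 0 < c ∧ ∀ x ∈ Ω, ∀ r : ℝ, 0 < r → r ≤ diam Ω / 4 →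
      c * r ^ n ≤ volume.real (innerBall Ω x r) := by
  set r₀ := diam Ω / 4 with hr₀
  have hr₀0 : 0 < r₀ := by positivity
  obtain ⟨M, hM, hMb⟩ := exists_le_measureReal_ball_inter hOpen hBdd hConn.nonempty hr₀0
  set c := min (1 / (K * 32 ^ n * 4 ^ n)) (M / (2 * r₀ ^ n)) with hc
  have hc0 : 0 < c := lt_min (by positivity) (by positivity)
  refine ⟨c, hc0, fun x hx r hr hrr => ?_⟩
  obtain ⟨k, hk⟩ := pow_unbounded_of_one_lt (r₀ / r) (one_lt_two (α := ℝ))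
  rw [div_lt_iff₀ hr] at hk
  induction k generalizing r with
  | zero => linarith
  | succ k ih =>
    have hBfin : ∀ s, volume (ball x s ∩ Ω) ≠ ⊤ := fun s =>
      measure_ne_top_of_subset inter_subset_left measure_ball_lt_top.ne
    have hsub : innerBall Ω x r ⊆ ball x (2 * r) ∩ Ω :=
      (innerBall_subset hOpen hConn hx r).trans
        (inter_subset_inter_left _ (ball_subset_ball (by linarith)))
    by_cases hE : volume.real (innerBall Ω x r) ≤
        volume.real ((ball x (2 * r) ∩ Ω) \ innerBall Ω x r)
    · refine le_trans ?_
        (hK.lt_measureReal_innerBall hn hOpen hConn hK0 hlam hx hr (by linarith) hE).le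
      gcongr
      exact min_le_left _ _
    · have hsum := measureReal_sdiff_add_inter (μ := volume) (s := ball x (2 * r) ∩ Ω)
        (isOpen_innerBall hOpen hConn hx r).measurableSet (hBfin _)
      rw [inter_eq_self_of_subset_right hsub] at hsum
      have hhalf : volume.real (ball x (2 * r) ∩ Ω) / 2 ≤ volume.real (innerBall Ω x r) := by
        linarith
      refine le_trans ?_ hhalf
      rcases le_or_gt (2 * r) r₀ with h2 | h2
      · have h3 := (ih (2 * r) (by linarith) h2 (by rw [pow_succ] at hk; linarith)).trans
          (measureReal_mono (innerBall_subset hOpen hConn hx (2 * r)) (hBfin _))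
        have h4 : (2 : ℝ) ≤ 2 ^ n := le_self_pow₀ one_le_two (by omega)
        have h5 : 0 < c * r ^ n := by positivity
        rw [mul_pow] at h3
        nlinarith
      · have h3 : M ≤ volume.real (ball x (2 * r) ∩ Ω) := (hMb x hx).trans
          (measureReal_mono (inter_subset_inter_left _ (ball_subset_ball h2.le)) (hBfin _))
        calc c * r ^ n ≤ M / (2 * r₀ ^ n) * r₀ ^ n := by
              gcongr
              exact min_le_right _ _
          _ = M / 2 := by field_simp
          _ ≤ _ := by linarith

lemma SeparationBound.min_measureReal_innerBall_le_of_innerDist (hn : 2 ≤ n) (hOpen : IsOpen Ω)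
    (hConn : IsConnected Ω) (hlam : 1 ≤ lam) (hK : SeparationBound n Ω K lam) {x y : Euc n}
    (hx : x ∈ Ω) (hy : y ∈ Ω) {ρ : ℝ} (hρ : 0 < ρ) (hxy : dist x y ≤ ρ) (hd : 2 * ρ < diam Ω)
    (hD : 2 * ρ < innerDist Ω x y) :
    min (volume.real (innerBall Ω x ρ)) (volume.real (innerBall Ω y ρ)) ≤
      K * (2 * ρ) ^ n * ((1 / (innerDist Ω x y - 2 * ρ)) ^ n *
        volume.real (ball x (lam * (2 * ρ)) ∩ Ω)) ^ 2 := by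
  set D := innerDist Ω x y with hDdef
  have hts : 0 < D - 2 * ρ := sub_pos.2 hD
  obtain ⟨k, hk⟩ : ∃ k : ℝ≥0, (k : ℝ) = 1 / (D - 2 * ρ) := ⟨⟨_, by positivity⟩, rfl⟩
  set u : Euc n → ℝ := fun z => 1 / (D - 2 * ρ) * (innerDist Ω x z - ρ) with hu
  have hLip : ∀ p δ, ball p δ ⊆ Ω → LipschitzOnWith k u (ball p δ) := by
    intro p δ hb
    refine LipschitzOnWith.of_dist_le_mul fun z hz w hw => ?_
    have h1 := (lipschitzOnWith_innerDist hOpen hConn hx hb).dist_le_mul z hz w hw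
    rw [NNReal.coe_one, one_mul, Real.dist_eq] at h1
    rw [Real.dist_eq, ← mul_sub, abs_mul, abs_of_pos (by positivity : 0 < 1 / (D - 2 * ρ)), hk,
      sub_sub_sub_cancel_right]
    gcongr
  have hTm : MeasurableSet (ball x (lam * (2 * ρ)) ∩ Ω) :=
    (isOpen_ball.inter hOpen).measurableSet
  obtain ⟨δ, hδ, hb⟩ := Metric.isOpen_iff.1 hOpen x hx
  refine hK u (.of_ball hOpen hLip) x hx (2 * ρ) (by positivity) hd _ ?_ ?_
    _ ?_ (isOpen_innerBall hOpen hConn hx ρ).measurableSet ?_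
    _ ?_ (isOpen_innerBall hOpen hConn hy ρ).measurableSet ?_
  · refine lintegral_fderiv_pow_pos hOpen hx (a := 1 / (D - 2 * ρ)) (b := -(1 / (D - 2 * ρ) * ρ))
      (by simpa using hts.ne') hδ ?_ hn (by positivity)
    intro z hz
    simp only [hu]
    rw [innerDist_eq_dist hOpen hConn hb (mem_ball_self hδ) hz]
    ring
  · rw [← hk]
    exact lintegral_fderiv_pow_le hOpen hLip (by omega) hTm
      (measure_ne_top_of_subset inter_subset_left measure_ball_lt_top.ne) inter_subset_right hTm
      fun z hz hz' => absurd hz hz'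
  · exact (innerBall_subset hOpen hConn hx ρ).trans
      (inter_subset_inter_left _ (ball_subset_ball (by linarith)))
  · intro z hz
    exact mul_nonpos_of_nonneg_of_nonpos (by positivity) (by linarith [hz.2])
  · refine (innerBall_subset hOpen hConn hy ρ).trans (inter_subset_inter_left _ ?_)
    refine ball_subset_ball' ?_
    rw [dist_comm]
    linarith
  · intro z hz
    simp only [hu]
    rw [one_div_mul_eq_div, one_le_div hts]
    have := innerDist_triangle hOpen hConn hx hz.1 hy
    rw [innerDist_comm Ω z y] at this
    linarith [hz.2]

lemma SeparationBound.exists_innerDist_le_of_dist_le (hn : 2 ≤ n) (hOpen : IsOpen Ω)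
    (hConn : IsConnected Ω) (hBdd : Bornology.IsBounded Ω) (hd : 0 < diam Ω) (hK0 : 0 < K)
    (hlam : 1 ≤ lam) (hK : SeparationBound n Ω K lam) :
    ∃ Q : ℝ, 0 < Q ∧ ∀ x ∈ Ω, ∀ y ∈ Ω, dist x y ≤ diam Ω / 4 →
      innerDist Ω x y ≤ Q * dist x y := by
  obtain ⟨c, hc, hreg⟩ := hK.exists_le_measureReal_innerBall hn hOpen hConn hBdd hd hK0 hlam
  set ω := volume.real (ball (0 : Euc n) 1) with hω
  have hω0 : 0 < ω := ENNReal.toReal_pos (measure_ball_pos _ _ one_pos).ne' measure_ball_lt_top.ne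
  set P := K * 2 ^ n * ((2 * lam) ^ n * ω) ^ 2 / c with hP
  refine ⟨2 + max 1 P, by positivity, fun x hx y hy hxy => ?_⟩
  rcases eq_or_ne x y with rfl | hne
  · obtain ⟨δ, hδ, hb⟩ := Metric.isOpen_iff.1 hOpen x hx
    simpa using innerDist_le_dist hb (mem_ball_self hδ) (mem_ball_self hδ)
  set ρ := dist x y with hρ
  have hρ0 : 0 < ρ := dist_pos.2 hne
  by_contra! hlt
  have hgap : max 1 P * ρ < innerDist Ω x y - 2 * ρ := by linarith
  have h1 : 0 < max 1 P * ρ := by positivity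
  have hcap := hK.min_measureReal_innerBall_le_of_innerDist hn hOpen hConn hlam hx hy hρ0 le_rfl
    (by linarith) (by linarith)
  have hvol : volume.real (ball x (lam * (2 * ρ)) ∩ Ω) ≤ (lam * (2 * ρ)) ^ n * ω := by
    refine (measureReal_mono inter_subset_left measure_ball_lt_top.ne).trans_eq ?_
    rw [measureReal_def, volume_ball_eq hn x (by positivity), ENNReal.toReal_ofReal (by positivity)]
  have hle := (le_min (hreg x hx ρ hρ0 hxy) (hreg y hy ρ hρ0 hxy)).trans hcap
  set g := innerDist Ω x y - 2 * ρ with hg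
  have hg0 : 0 < g := h1.trans hgap
  have h2 : c * ρ ^ n ≤ K * (2 * ρ) ^ n * ((1 / g) ^ n * ((lam * (2 * ρ)) ^ n * ω)) ^ 2 :=
    hle.trans (by gcongr)
  have h3 : (g / ρ) ^ (2 * n) ≤ P := by
    rw [hP, le_div_iff₀ hc, div_pow, div_mul_eq_mul_div, div_le_iff₀ (by positivity)]
    have h4 := mul_le_mul_of_nonneg_left h2 (by positivity : 0 ≤ g ^ (2 * n) / ρ ^ n)
    have e1 : g ^ (2 * n) / ρ ^ n * (c * ρ ^ n) = g ^ (2 * n) * c := by field_simp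
    have e2 : g ^ (2 * n) / ρ ^ n *
        (K * (2 * ρ) ^ n * ((1 / g) ^ n * ((lam * (2 * ρ)) ^ n * ω)) ^ 2) =
        K * 2 ^ n * ((2 * lam) ^ n * ω) ^ 2 * ρ ^ (2 * n) := by
      simp only [mul_pow, one_div_pow, mul_comm 2 n, pow_mul]
      field_simp
    rwa [e1, e2] at h4
  have h5 : max 1 P < g / ρ := (lt_div_iff₀ hρ0).2 hgap
  have h6 : g / ρ ≤ (g / ρ) ^ (2 * n) :=
    le_self_pow₀ ((le_max_left 1 P).trans h5.le) (by omega)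
  exact absurd (le_max_right 1 P) (not_le.2 (h5.trans_le (h6.trans h3)))

lemma exists_innerDist_le (hOpen : IsOpen Ω) (hConn : IsConnected Ω)
    (hBdd : Bornology.IsBounded Ω) {Q r : ℝ} (hQ : 0 < Q) (hr : 0 < r)
    (h : ∀ x ∈ Ω, ∀ y ∈ Ω, dist x y ≤ r → innerDist Ω x y ≤ Q * dist x y) :
    ∃ C : ℝ, 1 ≤ C ∧ ∀ x ∈ Ω, ∀ y ∈ Ω, innerDist Ω x y ≤ C * dist x y := by
  obtain ⟨t, htΩ, hfin, hcov⟩ := exists_finite_cover hBdd hr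
  obtain ⟨N, hN⟩ := ((hfin.prod hfin).image fun p => innerDist Ω p.1 p.2).bddAbove
  refine ⟨max 1 (max Q ((2 * (Q * r) + N) / r)), le_max_left _ _, fun x hx y hy => ?_⟩
  rcases le_or_gt (dist x y) r with hxy | hxy
  · refine (h x hx y hy hxy).trans ?_
    gcongr
    exact (le_max_left _ _).trans (le_max_right _ _)
  · obtain ⟨p, hp, hxp⟩ := hcov x hx
    obtain ⟨q, hq, hyq⟩ := hcov y hy
    have hpq : innerDist Ω p q ≤ N := hN (mem_image_of_mem _ (mk_mem_prod hp hq))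
    have h1 := (h x hx p (htΩ hp) hxp.le).trans (mul_le_mul_of_nonneg_left hxp.le hQ.le)
    have h2 := (h y hy q (htΩ hq) hyq.le).trans (mul_le_mul_of_nonneg_left hyq.le hQ.le)
    have h3 := innerDist_triangle hOpen hConn hx (htΩ hp) hy
    have h4 := innerDist_triangle hOpen hConn (htΩ hp) (htΩ hq) hy
    rw [innerDist_comm Ω q y] at h4
    have hN0 : 0 ≤ N := (innerDist_nonneg Ω p q).trans hpq
    calc innerDist Ω x y ≤ 2 * (Q * r) + N := by linarith
      _ = (2 * (Q * r) + N) / r * r := by field_simp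
      _ ≤ _ := by
        gcongr
        exact (le_max_right _ _).trans (le_max_right _ _)

lemma isQuasiconvex_of_innerDist_le (hOpen : IsOpen Ω) (hConn : IsConnected Ω) {C : ℝ}
    (hC : 1 ≤ C) (h : ∀ x ∈ Ω, ∀ y ∈ Ω, innerDist Ω x y ≤ C * dist x y) : IsQuasiconvex Ω := by
  refine ⟨2 * C, by linarith, fun x hx y hy => ?_⟩
  rcases eq_or_ne x y with rfl | hne
  · exact ⟨fun _ => x, continuousOn_const, rfl, rfl, fun _ _ => hx, by
      rw [eVariationOn.constant_on
        (subsingleton_singleton.anti (image_subset_iff.2 fun _ _ => rfl))]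
      exact zero_le⟩
  · have hpos : 0 < C * dist x y := mul_pos (by linarith) (dist_pos.2 hne)
    have hlt : intrinsicDist Ω x y < ENNReal.ofReal (2 * C * dist x y) := by
      rw [ENNReal.lt_ofReal_iff_toReal_lt (intrinsicDist_ne_top hOpen hConn hx hy)]
      have := h x hx y hy
      change innerDist Ω x y < _
      linarith
    obtain ⟨γ, ⟨h1, h2, h3, h4⟩, h5⟩ := exists_curve_of_intrinsicDist_lt hlt
    exact ⟨γ, h1, h2, h3, h4, h5.le⟩

end Trudinger

/-- a bounded local Sobolev–Poincaré imbedding domain of order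
`n` is quasiconvex. -/
theorem stmt17 (n : ℕ) (hn : 2 ≤ n)
    (Ω : Set (Euc n)) (hOpen : IsOpen Ω)
    (hConn : IsConnected Ω) (hBdd : Bornology.IsBounded Ω)
    (hSP : LocalSPn n Ω) :
    IsQuasiconvex Ω := by
  obtain ⟨K, hK0, lam, hlam, hK⟩ := hSP.exists_separationBound hn
  have hd : 0 < diam Ω := by
    have : Nontrivial (Euc n) := by
      have : Nonempty (Fin n) := ⟨⟨0, by omega⟩⟩
      infer_instance
    obtain ⟨x, hx⟩ := hConn.nonempty
    have := Module.punctured_nhds_neBot ℝ (Euc n) x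
    exact diam_pos (infinite_of_mem_nhds x (hOpen.mem_nhds hx)).nontrivial hBdd
  obtain ⟨Q, hQ, hloc⟩ :=
    hK.exists_innerDist_le_of_dist_le hn hOpen hConn hBdd hd hK0 hlam
  obtain ⟨C, hC, hglob⟩ := exists_innerDist_le hOpen hConn hBdd hQ (by positivity) hloc
  exact isQuasiconvex_of_innerDist_le hOpen hConn hC hglob
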